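/- If Σ' ⊊ S is a subset with W_{Σ'} finite and y' ∈ W^{Σ'} is such that y' W_{Σ'} y'⁻¹ = W_Σ, then Σ' = Σ. Moreover, the group W̃ acts simply transitively by left translation on the set C(Σ) = {y W_Σ : y ∈ W^Σ, y W_Σ y⁻¹ = W_Σ} of left cosets; equivalently, for every coset y W_Σ with y ∈ W^Σ and y W_Σ y⁻¹ = W_Σ there is a unique w̃ ∈ W̃ with y W_Σ = w̃ W_Σ. -/

import Mathlib

/-!
Relative Coxeter groups: common definitions.

`(W, S)` is a Coxeter system (Mathlib's `CoxeterSystem M W`), `ℓ = cs.length`.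
For `w : W`, `invSet cs w` is the set `T(w)` of left inversions of `w`, and
`descSet cs w = T(w) ∩ S` is `D(w)`.  For a subset `Sg ⊆ S` (playing the role of `Σ`),
`par Sg` is the standard parabolic subgroup `W_Σ`, `parRefl Sg` its set of
reflections `T_Σ`, `minRight cs Sg = W^Σ`, `minLeft cs Sg = ^ΣW`,
`relN cs Sg Sg' = N(Σ, Σ')`, `IsLongest cs Sg w` says `w` is a longest element of `W_Σ`,
`longest cs Sg` is the longest element `w₀^Σ`, `relW cs Sg = W̃`,
`complSet cs Sg = Σ^∁`, `tilde cs Sg s = s̃ = w₀^{Σ∪{s}} w₀^Σ`, `relS cs Sg = S̃`,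
`relLength cs Sg = ℓ̃ : W → ℕ∞`, and `GoodSubset cs Sg` records the standing
hypotheses (1) and (2) on `Σ`.
-/

namespace RelativeCoxeter

variable {B W : Type*} [Group W] {M : CoxeterMatrix B}

/-- The set `S` of simple reflections of the Coxeter system. -/
def simpleSet (cs : CoxeterSystem M W) : Set W := Set.range cs.simple

/-- `T(w)`: the set of left inversions of `w`, i.e. reflections `t` with `ℓ(tw) < ℓ(w)`. -/
def invSet (cs : CoxeterSystem M W) (w : W) : Set W :=
  {t | cs.IsReflection t ∧ cs.length (t * w) < cs.length w}

/-- `D(w) = T(w) ∩ S`. -/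
def descSet (cs : CoxeterSystem M W) (w : W) : Set W :=
  invSet cs w ∩ simpleSet cs

/-- The standard parabolic subgroup `W_Σ` generated by `Σ`. -/
def par (Sg : Set W) : Subgroup W := Subgroup.closure Sg

/-- `T_Σ`: the set of reflections of the Coxeter system `(W_Σ, Σ)`. -/
def parRefl (Sg : Set W) : Set W :=
  {t | ∃ u ∈ par Sg, ∃ s ∈ Sg, t = u * s * u⁻¹}

/-- `W^Σ = {w : T(w⁻¹) ∩ T_Σ = ∅}`, minimal-length representatives of `W/W_Σ`. -/
def minRight (cs : CoxeterSystem M W) (Sg : Set W) : Set W :=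
  {w | invSet cs w⁻¹ ∩ parRefl Sg = ∅}

/-- `^ΣW = {w : T(w) ∩ T_Σ = ∅}`, minimal-length representatives of `W_Σ\W`. -/
def minLeft (cs : CoxeterSystem M W) (Sg : Set W) : Set W :=
  {w | invSet cs w ∩ parRefl Sg = ∅}

/-- `N(Σ, Σ') = {y ∈ W^Σ ∩ ^{Σ'}W : y W_Σ y⁻¹ = W_{Σ'}}`. -/
def relN (cs : CoxeterSystem M W) (Sg Sg' : Set W) : Set W :=
  {y | y ∈ minRight cs Sg ∧ y ∈ minLeft cs Sg' ∧
    (fun u => y * u * y⁻¹) '' (par Sg : Set W) = (par Sg' : Set W)}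

/-- `w` is a longest element of `W_Σ`. -/
def IsLongest (cs : CoxeterSystem M W) (Sg : Set W) (w : W) : Prop :=
  w ∈ par Sg ∧ ∀ u ∈ par Sg, cs.length u ≤ cs.length w

/-- The longest element `w₀^Σ` of `W_Σ` (defined when it exists; junk value `1` otherwise). -/
noncomputable def longest (cs : CoxeterSystem M W) (Sg : Set W) : W :=
  letI := Classical.propDecidable (∃ w, IsLongest cs Sg w)
  if h : ∃ w, IsLongest cs Sg w then h.choose else 1

/-- `W̃ = {w : w W_Σ w⁻¹ = W_Σ and T(w) ∩ T_Σ = ∅}`. -/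
def relW (cs : CoxeterSystem M W) (Sg : Set W) : Set W :=
  {w | (fun u => w * u * w⁻¹) '' (par Sg : Set W) = (par Sg : Set W) ∧
    invSet cs w ∩ parRefl Sg = ∅}

/-- `Σ^∁ = {s ∈ S ∖ Σ : W_{Σ∪{s}} is finite}`. -/
def complSet (cs : CoxeterSystem M W) (Sg : Set W) : Set W :=
  {s ∈ simpleSet cs \ Sg | ((par (Sg ∪ {s}) : Set W)).Finite}

/-- `s̃ = w₀^{Σ∪{s}} w₀^Σ`. -/
noncomputable def tilde (cs : CoxeterSystem M W) (Sg : Set W) (s : W) : W :=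
  longest cs (Sg ∪ {s}) * longest cs Sg

/-- `S̃ = {s̃ : s ∈ Σ^∁}`. -/
noncomputable def relS (cs : CoxeterSystem M W) (Sg : Set W) : Set W :=
  {w | ∃ s ∈ complSet cs Sg, w = tilde cs Sg s}

/-- `ℓ̃(w) ∈ ℕ ∪ {∞}`: the minimal `q` such that `w = w₁ ⋯ w_q` with all `w_i ∈ S̃`. -/
noncomputable def relLength (cs : CoxeterSystem M W) (Sg : Set W) (w : W) : ℕ∞ :=
  sInf {q : ℕ∞ | ∃ l : List W, (∀ x ∈ l, x ∈ relS cs Sg) ∧ l.prod = w ∧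
    (l.length : ℕ∞) = q}

/-- The standing hypotheses on `Σ`: `Σ ⊆ S`, `W_Σ` is finite, and for every `Σ'` with
`Σ ⊆ Σ' ⊆ S` and `W_{Σ'}` finite, the longest element `w₀^{Σ'}` normalises `W_Σ`. -/
def GoodSubset (cs : CoxeterSystem M W) (Sg : Set W) : Prop :=
  Sg ⊆ simpleSet cs ∧ ((par Sg : Set W)).Finite ∧
  ∀ Sg' : Set W, Sg ⊆ Sg' → Sg' ⊆ simpleSet cs → ((par Sg' : Set W)).Finite →
    ∀ w0 : W, IsLongest cs Sg' w0 →
      (fun u => w0 * u * w0⁻¹) '' (par Sg : Set W) = (par Sg : Set W)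

variable (cs : CoxeterSystem M W)

section ReflectionCocycle

open Classical in
/-- The involution `(t, ε) ↦ (s t s, ε + [t = s])` of `W × ℤ/2` attached to an involution `s`. -/
noncomputable def signedConj (s : W) (hs : s * s = 1) : Equiv.Perm (W × ZMod 2) :=
  Function.Involutive.toPerm (fun p => (s * p.1 * s, p.2 + if p.1 = s then 1 else 0)) (by
    rintro ⟨t, e⟩
    have h1 : s * (s * t * s) * s = t := by
      rw [show s * (s * t * s) * s = (s * s) * t * (s * s) by group, hs]; simp
    have h2 : s * t * s = s ↔ t = s := by
      constructor
      · intro h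
        rw [← h1, h, hs, one_mul]
      · rintro rfl
        rw [hs, one_mul]
    simp only [h1, h2, Prod.mk.injEq, true_and, add_assoc]
    by_cases h : t = s <;> simp [h, CharTwo.add_self_eq_zero])

open Classical in
theorem signedConj_apply (s : W) (hs : s * s = 1) (t : W) (e : ZMod 2) :
    signedConj s hs (t, e) = (s * t * s, e + if t = s then 1 else 0) := rfl

open Classical in
theorem signedConj_mul_pow_apply (a b : W) (ha : a * a = 1) (hb : b * b = 1) (n : ℕ)
    (t : W) (e : ZMod 2) :
    ((signedConj a ha * signedConj b hb) ^ n) (t, e) =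
      ((a * b) ^ n * t * ((a * b) ^ n)⁻¹,
        e + ∑ k ∈ Finset.range (2 * n), if t = b * (a * b) ^ k then 1 else 0) := by
  have ha' : a⁻¹ = a := inv_eq_of_mul_eq_one_left ha
  have hb' : b⁻¹ = b := inv_eq_of_mul_eq_one_left hb
  have hflip : ∀ n : ℕ, b * (a * b) ^ n = ((a * b) ^ n)⁻¹ * b := by
    intro n
    have h1 : b * (a * b) * b⁻¹ = (a * b)⁻¹ := by
      rw [mul_inv_rev, ha', hb']
      rw [show b * (a * b) * b = b * a * (b * b) by group, hb, mul_one]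
    have h2 := conj_pow (a := b) (b := a * b) (i := n)
    rw [h1, inv_pow] at h2
    rw [h2]; group
  induction n with
  | zero => simp
  | succ n ih =>
    rw [pow_succ', Equiv.Perm.mul_apply, ih, Equiv.Perm.mul_apply, signedConj_apply,
      signedConj_apply, show 2 * (n + 1) = 2 * n + 1 + 1 by ring, Finset.sum_range_succ,
      Finset.sum_range_succ]
    have e1 : (a * b) ^ n * t * ((a * b) ^ n)⁻¹ = b ↔ t = b * (a * b) ^ (2 * n) := by
      rw [two_mul, pow_add, ← mul_assoc, hflip, mul_inv_eq_iff_eq_mul, mul_assoc _ b,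
        eq_inv_mul_iff_mul_eq]
    have e2 : b * ((a * b) ^ n * t * ((a * b) ^ n)⁻¹) * b = a ↔
        t = b * (a * b) ^ (2 * n + 1) := by
      have key : ∀ P x y : W, y * (P * t * P⁻¹) * y = x ↔ t = P⁻¹ * (y⁻¹ * x * y⁻¹) * P := by
        intro P x y
        constructor <;> rintro rfl <;> group
      rw [key, hb', two_mul, add_assoc, pow_add, ← mul_assoc b (_ ^ n), hflip, pow_succ']
      simp only [mul_assoc]
    simp only [e1, e2, Prod.mk.injEq, add_assoc, and_true]
    rw [pow_succ' (a * b) n, mul_inv_rev, mul_inv_rev, ha', hb']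
    group

/-- The action of `W` on `W × ℤ/2` in which each simple reflection acts by `signedConj`. -/
noncomputable def signedConjHom : W →* Equiv.Perm (W × ZMod 2) :=
  cs.lift ⟨fun i => signedConj (cs.simple i) (cs.simple_mul_simple_self i), by
    classical
    intro i j
    ext1 ⟨t, e⟩
    rw [signedConj_mul_pow_apply, cs.simple_mul_simple_pow, two_mul, Finset.sum_range_add]
    simp [pow_add, CharTwo.add_self_eq_zero]⟩

theorem signedConjHom_simple (i : B) :
    signedConjHom cs (cs.simple i) =
      signedConj (cs.simple i) (cs.simple_mul_simple_self i) :=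
  cs.lift_apply_simple _ i

/-- The reflection cocycle: the sign picked up by `(t, 0)` under the action of `w`. -/
noncomputable def reflCocycle (w t : W) : ZMod 2 := (signedConjHom cs w (t, 0)).2

theorem signedConjHom_apply (w t : W) (e : ZMod 2) :
    signedConjHom cs w (t, e) = (w * t * w⁻¹, e + reflCocycle cs w t) := by
  classical
  unfold reflCocycle
  induction w using cs.simple_induction_left generalizing t e with
  | one => simp
  | mul_simple_left w i ih =>
    rw [map_mul, Equiv.Perm.mul_apply, Equiv.Perm.mul_apply, ih t e, ih t 0,
      signedConjHom_simple, signedConj_apply, signedConj_apply]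
    simp [mul_assoc, add_assoc]

theorem reflCocycle_mul (x y t : W) :
    reflCocycle cs (x * y) t = reflCocycle cs y t + reflCocycle cs x (y * t * y⁻¹) := by
  have h := signedConjHom_apply cs (x * y) t 0
  rw [map_mul, Equiv.Perm.mul_apply, signedConjHom_apply, signedConjHom_apply] at h
  simpa using (congrArg Prod.snd h).symm

theorem reflCocycle_one (t : W) : reflCocycle cs 1 t = 0 := by
  simp [reflCocycle]

open Classical in
theorem reflCocycle_simple (i : B) (t : W) :
    reflCocycle cs (cs.simple i) t = if t = cs.simple i then 1 else 0 := by
  simp [reflCocycle, signedConjHom_simple, signedConj_apply]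

theorem reflCocycle_self {t : W} (ht : cs.IsReflection t) : reflCocycle cs t t = 1 := by
  obtain ⟨x, i, rfl⟩ := ht
  have h := reflCocycle_mul cs x x⁻¹ (x * cs.simple i * x⁻¹)
  rw [mul_inv_cancel, reflCocycle_one] at h
  have e1 : x⁻¹ * (x * cs.simple i * x⁻¹) * x⁻¹⁻¹ = cs.simple i := by group
  rw [reflCocycle_mul, reflCocycle_mul, e1]
  rw [e1] at h
  simp only [reflCocycle_simple, mul_assoc, mul_inv_cancel, mul_one, if_true] at h ⊢
  linear_combination -h

theorem mem_rightInvSeq_of_reflCocycle_ne_zero (ω : List B) (t : W)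
    (h : reflCocycle cs (cs.wordProd ω) t ≠ 0) : t ∈ cs.rightInvSeq ω := by
  induction ω with
  | nil => simp [reflCocycle_one] at h
  | cons i ω ih =>
    rw [cs.wordProd_cons, reflCocycle_mul, reflCocycle_simple] at h
    rw [CoxeterSystem.rightInvSeq, List.mem_cons]
    by_cases h1 : cs.wordProd ω * t * (cs.wordProd ω)⁻¹ = cs.simple i
    · left
      rw [← h1]; group
    · right
      apply ih
      simpa [h1] using h

theorem reflCocycle_eq_one_iff {t : W} (ht : cs.IsReflection t) (w : W) :
    reflCocycle cs w t = 1 ↔ cs.length (w * t) < cs.length w := by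
  have key : ∀ w, reflCocycle cs w t = 1 → cs.length (w * t) < cs.length w := by
    intro w hw
    obtain ⟨ω, hω, rfl⟩ := cs.exists_isReduced w
    refine (cs.isRightInversion_of_mem_rightInvSeq hω
      (mem_rightInvSeq_of_reflCocycle_ne_zero cs ω t ?_)).2
    simp [hw]
  refine ⟨key w, fun h => ?_⟩
  have h01 : ∀ a : ZMod 2, a = 0 ∨ a = 1 := by decide
  rcases h01 (reflCocycle cs w t) with h0 | h1
  · have := key (w * t) (by
      rw [reflCocycle_mul, reflCocycle_self cs ht, mul_inv_cancel_right, h0, add_zero])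
    rw [mul_assoc, ht.mul_self, mul_one] at this
    omega
  · exact h1

theorem mem_invSet_iff_reflCocycle {t w : W} :
    t ∈ invSet cs w ↔ cs.IsReflection t ∧ reflCocycle cs w⁻¹ t = 1 := by
  refine and_congr_right fun ht => ?_
  rw [reflCocycle_eq_one_iff cs ht, cs.length_inv, ← cs.length_inv (t * w), mul_inv_rev, ht.inv]

theorem mem_invSet_mul {t x y : W} (ht : cs.IsReflection t) :
    t ∈ invSet cs (x * y) ↔ Xor (t ∈ invSet cs x) (x⁻¹ * t * x ∈ invSet cs y) := by
  have ht' : cs.IsReflection (x⁻¹ * t * x) := by simpa using ht.conj x⁻¹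
  simp only [mem_invSet_iff_reflCocycle, ht, ht', true_and, mul_inv_rev]
  rw [reflCocycle_mul, inv_inv]
  generalize reflCocycle cs x⁻¹ t = a
  generalize reflCocycle cs y⁻¹ _ = b
  revert a b
  unfold Xor
  decide

/-- Strong exchange condition. -/
theorem exists_eraseIdx_of_mem_invSet {t : W} (ω : List B) (h : t ∈ invSet cs (cs.wordProd ω)) :
    ∃ j < ω.length, t * cs.wordProd ω = cs.wordProd (ω.eraseIdx j) := by
  have h2 : t ∈ cs.leftInvSeq ω := by
    rw [← List.reverse_reverse ω, cs.leftInvSeq_reverse, List.mem_reverse]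
    apply mem_rightInvSeq_of_reflCocycle_ne_zero
    rw [cs.wordProd_reverse, ((mem_invSet_iff_reflCocycle cs).1 h).2]
    exact one_ne_zero
  obtain ⟨j, hj, rfl⟩ := List.mem_iff_getElem.mp h2
  refine ⟨j, by simpa using hj, ?_⟩
  rw [← List.getD_eq_getElem _ 1 hj, cs.getD_leftInvSeq_mul_wordProd]

end ReflectionCocycle

section Parabolic

variable {I : Set W}

theorem isReflection_of_mem_simpleSet {s : W} (hs : s ∈ simpleSet cs) : cs.IsReflection s := by
  obtain ⟨i, rfl⟩ := hs
  exact cs.isReflection_simple i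

theorem length_of_mem_simpleSet {s : W} (hs : s ∈ simpleSet cs) : cs.length s = 1 := by
  obtain ⟨i, rfl⟩ := hs
  exact cs.length_simple i

theorem mem_par_of_mem_parRefl {t : W} (ht : t ∈ parRefl I) : t ∈ par I := by
  obtain ⟨u, hu, s, hs, rfl⟩ := ht
  exact mul_mem (mul_mem hu (Subgroup.subset_closure hs)) (inv_mem hu)

theorem conj_mem_parRefl {t u : W} (ht : t ∈ parRefl I) (hu : u ∈ par I) :
    u * t * u⁻¹ ∈ parRefl I := by
  obtain ⟨x, hx, s, hs, rfl⟩ := ht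
  exact ⟨u * x, mul_mem hu hx, s, hs, by group⟩

theorem mem_parRefl_of_mem {s : W} (hs : s ∈ I) : s ∈ parRefl I :=
  ⟨1, one_mem _, s, hs, by simp⟩

theorem exists_reduced_word_of_mem_par (hI : I ⊆ simpleSet cs) {u : W} (hu : u ∈ par I) :
    ∃ ω : List B, cs.IsReduced ω ∧ cs.wordProd ω = u ∧ ∀ i ∈ ω, cs.simple i ∈ I := by
  have step : ∀ s ∈ I, ∀ y : W,
      (∃ ω : List B, cs.IsReduced ω ∧ cs.wordProd ω = y ∧ ∀ i ∈ ω, cs.simple i ∈ I) →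
      ∃ ω : List B, cs.IsReduced ω ∧ cs.wordProd ω = s * y ∧ ∀ i ∈ ω, cs.simple i ∈ I := by
    rintro s hs _ ⟨ω, hω, rfl, hωI⟩
    obtain ⟨i, rfl⟩ := hI hs
    rcases cs.length_simple_mul (cs.wordProd ω) i with h | h
    · refine ⟨i :: ω, ?_, cs.wordProd_cons i ω, ?_⟩
      · rw [CoxeterSystem.IsReduced, cs.wordProd_cons, h, hω.eq, List.length_cons]
      · intro j hj
        rcases List.mem_cons.1 hj with rfl | hj
        · exact hs
        · exact hωI j hj
    · obtain ⟨j, hj, h2⟩ := exists_eraseIdx_of_mem_invSet cs ω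
        (t := cs.simple i) ⟨cs.isReflection_simple i, by omega⟩
      refine ⟨ω.eraseIdx j, ?_, h2.symm, fun k hk => hωI k (List.mem_of_mem_eraseIdx hk)⟩
      have := List.length_eraseIdx_add_one hj
      rw [hω.eq] at h
      rw [CoxeterSystem.IsReduced, ← h2]
      omega
  induction hu using Subgroup.closure_induction_left with
  | one => exact ⟨[], by simp [CoxeterSystem.IsReduced], by simp, by simp⟩
  | mul_left s hs y hy ih => exact step s hs y ih
  | inv_mul_cancel s hs y hy ih =>
    rw [(isReflection_of_mem_simpleSet cs (hI hs)).inv]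
    exact step s hs y ih

theorem exists_left_factor (hI : I ⊆ simpleSet cs) {u : W} (hu : u ∈ par I) (h1 : u ≠ 1) :
    ∃ s ∈ I, ∃ u' ∈ par I, u = s * u' ∧ cs.length u = cs.length u' + 1 := by
  obtain ⟨ω, hω, rfl, hωI⟩ := exists_reduced_word_of_mem_par cs hI hu
  cases ω with
  | nil => simp at h1
  | cons i ω =>
    have hi : cs.simple i ∈ I := hωI i (by simp)
    refine ⟨cs.simple i, hi, cs.wordProd ω, ?_, cs.wordProd_cons i ω, ?_⟩
    · rw [cs.wordProd_cons] at hu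
      exact (Subgroup.mul_mem_cancel_left _ (Subgroup.subset_closure hi)).1 hu
    · have hω' : cs.IsReduced ω := hω.drop 1
      rw [hω.eq, hω'.eq, List.length_cons]

theorem exists_right_factor (hI : I ⊆ simpleSet cs) {u : W} (hu : u ∈ par I) (h1 : u ≠ 1) :
    ∃ s ∈ I, ∃ u' ∈ par I, u = u' * s ∧ cs.length u = cs.length u' + 1 := by
  obtain ⟨s, hs, u', hu', h, hl⟩ := exists_left_factor cs hI (inv_mem hu) (inv_ne_one.2 h1)
  refine ⟨s, hs, u'⁻¹, inv_mem hu', ?_, ?_⟩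
  · rw [← inv_inv u, h, mul_inv_rev, (isReflection_of_mem_simpleSet cs (hI hs)).inv]
  · rw [cs.length_inv, ← cs.length_inv u, hl]

theorem mem_of_mem_par_of_length_le_one (hI : I ⊆ simpleSet cs) {t : W} (ht : t ∈ par I)
    (h1 : t ≠ 1) (hl : cs.length t ≤ 1) : t ∈ I := by
  obtain ⟨s, hs, u, -, h, hlen⟩ := exists_left_factor cs hI ht h1
  have : u = 1 := cs.length_eq_zero_iff.1 (by omega)
  rwa [h, this, mul_one]

theorem invSet_subset_parRefl (hI : I ⊆ simpleSet cs) {u : W} (hu : u ∈ par I) :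
    invSet cs u ⊆ parRefl I := by
  induction hn : cs.length u generalizing u with
  | zero =>
    intro t ht
    have := ht.2
    omega
  | succ n ih =>
    have h1 : u ≠ 1 := by rintro rfl; simp at hn
    obtain ⟨s, hs, u', hu', rfl, hl⟩ := exists_left_factor cs hI hu h1
    intro t ht
    have hs' : s⁻¹ = s := (isReflection_of_mem_simpleSet cs (hI hs)).inv
    rcases (mem_invSet_mul cs ht.1).1 ht with ⟨h, -⟩ | ⟨h, -⟩
    · have h0 : cs.length (t * s) = 0 := by
        have := h.2
        rw [length_of_mem_simpleSet cs (hI hs)] at this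
        omega
      have : t = s := by
        rw [cs.length_eq_zero_iff, mul_eq_one_iff_eq_inv, hs'] at h0
        exact h0
      rw [this]
      exact mem_parRefl_of_mem hs
    · have := conj_mem_parRefl (ih hu' (by omega) h) (Subgroup.subset_closure hs)
      rwa [show s * (s⁻¹ * t * s) * s⁻¹ = t by group] at this

theorem mem_parRefl_of_isReflection (hI : I ⊆ simpleSet cs) {t : W} (ht : cs.IsReflection t)
    (htI : t ∈ par I) : t ∈ parRefl I := by
  refine invSet_subset_parRefl cs hI htI ⟨ht, ?_⟩
  rw [ht.mul_self, cs.length_one]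
  have := ht.odd_length.pos
  omega

theorem length_mul_of_mem_minLeft (hI : I ⊆ simpleSet cs) {u v : W} (hu : u ∈ par I)
    (hv : v ∈ minLeft cs I) : cs.length (u * v) = cs.length u + cs.length v := by
  induction hn : cs.length u generalizing u with
  | zero => rw [cs.length_eq_zero_iff.1 hn]; simp
  | succ n ih =>
    have h1 : u ≠ 1 := by rintro rfl; simp at hn
    obtain ⟨s, hs, u', hu', rfl, hl⟩ := exists_left_factor cs hI hu h1
    have hsr := isReflection_of_mem_simpleSet cs (hI hs)
    have hs' : s ∉ invSet cs (u' * v) := by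
      rw [mem_invSet_mul cs hsr]
      rintro (⟨h, -⟩ | ⟨h, -⟩)
      · have := h.2
        omega
      · refine (Set.eq_empty_iff_forall_notMem.1 hv) _ ⟨h, ?_⟩
        simpa using conj_mem_parRefl (mem_parRefl_of_mem hs) (inv_mem hu')
    have ih' := ih hu' (by omega)
    have hge : ¬ cs.length (s * (u' * v)) < cs.length (u' * v) := fun h => hs' ⟨hsr, h⟩
    have hne := hsr.length_mul_right_ne (u' * v)
    have hle := cs.length_mul_le s (u' * v)
    rw [length_of_mem_simpleSet cs (hI hs)] at hle
    rw [mul_assoc]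
    omega

theorem exists_mem_par_mul_minLeft (w : W) :
    ∃ u ∈ par I, ∃ v ∈ minLeft cs I, w = u * v := by
  have hex : ∃ n, ∃ u ∈ par I, cs.length (u * w) = n := ⟨_, 1, one_mem _, rfl⟩
  classical
  obtain ⟨u, hu, hl⟩ := Nat.find_spec hex
  refine ⟨u⁻¹, inv_mem hu, u * w, ?_, by group⟩
  refine Set.eq_empty_iff_forall_notMem.2 ?_
  rintro t ⟨ht, htI⟩
  have h2 := ht.2
  rw [hl] at h2
  exact Nat.find_min hex h2
    ⟨t * u, mul_mem (mem_par_of_mem_parRefl htI) hu, by rw [mul_assoc]⟩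

theorem conj_mem_of_mem_minLeft (hI : I ⊆ simpleSet cs) {v s : W} (hv : v ∈ minLeft cs I)
    (hs : s ∈ simpleSet cs) (h : v * s * v⁻¹ ∈ par I) : v * s * v⁻¹ ∈ I := by
  refine mem_of_mem_par_of_length_le_one cs hI h ?_ ?_
  · intro h1
    have : s = 1 := by simpa using h1
    have := length_of_mem_simpleSet cs hs
    simp_all
  · have h1 := length_mul_of_mem_minLeft cs hI h hv
    rw [inv_mul_cancel_right] at h1
    have h2 := cs.length_mul_le v s
    rw [length_of_mem_simpleSet cs hs] at h2
    omega

theorem minRight_iff_inv_minLeft {w : W} : w ∈ minRight cs I ↔ w⁻¹ ∈ minLeft cs I := Iff.rfl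

theorem mem_minLeft_of_length_mul {u v : W} (hl : cs.length (u * v) = cs.length u + cs.length v)
    (h : u * v ∈ minLeft cs I) : u ∈ minLeft cs I := by
  refine Set.eq_empty_iff_forall_notMem.2 ?_
  rintro t ⟨ht, htI⟩
  refine Set.eq_empty_iff_forall_notMem.1 h t ⟨⟨ht.1, ?_⟩, htI⟩
  have := ht.2
  have := cs.length_mul_le (t * u) v
  rw [← mul_assoc]
  omega

theorem mem_minRight_of_length_mul {u v : W} (hl : cs.length (u * v) = cs.length u + cs.length v)
    (h : u * v ∈ minRight cs I) : v ∈ minRight cs I := by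
  rw [minRight_iff_inv_minLeft] at h ⊢
  rw [mul_inv_rev] at h
  refine mem_minLeft_of_length_mul cs ?_ h
  rw [← mul_inv_rev, cs.length_inv, cs.length_inv, cs.length_inv, hl, add_comm]

theorem mem_minLeft_of_conj {J : Set W} (hJ : J ⊆ simpleSet cs) {y : W}
    (hy : y ∈ minRight cs J) (hconj : ∀ t ∈ par I, y⁻¹ * t * y ∈ par J) : y ∈ minLeft cs I := by
  refine Set.eq_empty_iff_forall_notMem.2 ?_
  rintro t ⟨ht, htI⟩
  have hr : cs.IsReflection (y⁻¹ * t * y) := by simpa using ht.1.conj y⁻¹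
  refine Set.eq_empty_iff_forall_notMem.1 hy (y⁻¹ * t * y) ⟨⟨hr, ?_⟩, ?_⟩
  · rw [mul_inv_cancel_right, ← ht.1.inv, ← mul_inv_rev, cs.length_inv, cs.length_inv]
    exact ht.2
  · exact mem_parRefl_of_isReflection cs hJ hr (hconj t (mem_par_of_mem_parRefl htI))

theorem length_mul_inv_add_of_descents (hI : I ⊆ simpleSet cs) {m : W}
    (hm : ∀ s ∈ I, cs.length (m * s) < cs.length m) {x : W} (hx : x ∈ par I) :
    cs.length m = cs.length (m * x⁻¹) + cs.length x := by
  induction hn : cs.length x generalizing x with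
  | zero => rw [cs.length_eq_zero_iff.1 hn]; simp
  | succ n ih =>
    have h1 : x ≠ 1 := by rintro rfl; simp at hn
    obtain ⟨s, hs, x', hx', rfl, hl⟩ := exists_right_factor cs hI hx h1
    have hsr := isReflection_of_mem_simpleSet cs (hI hs)
    have ih' := ih hx' (by omega)
    have hd := hm s hs
    rw [← reflCocycle_eq_one_iff cs hsr] at hd
    have hd' : reflCocycle cs x' s ≠ 1 := by
      rw [ne_eq, reflCocycle_eq_one_iff cs hsr]
      omega
    have hsum := reflCocycle_mul cs (m * x'⁻¹) x' s
    rw [inv_mul_cancel_right, hd] at hsum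
    have h2 : reflCocycle cs (m * x'⁻¹) (x' * s * x'⁻¹) = 1 := by
      revert hsum hd'
      generalize reflCocycle cs x' s = a
      generalize reflCocycle cs (m * x'⁻¹) _ = b
      revert a b
      decide
    rw [reflCocycle_eq_one_iff cs (hsr.conj x'),
      show m * x'⁻¹ * (x' * s * x'⁻¹) = m * (x' * s)⁻¹ by
        rw [mul_inv_rev, hsr.inv]; group] at h2
    have h3 := cs.length_mul_le (m * (x' * s)⁻¹) (x' * s)
    rw [inv_mul_cancel_right] at h3
    omega

theorem finite_par_of_descents (hI : I ⊆ simpleSet cs) (hfin : I.Finite) {m : W}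
    (hm : ∀ s ∈ I, cs.length (m * s) < cs.length m) : (par I : Set W).Finite := by
  have hball : ∀ n, {x | x ∈ par I ∧ cs.length x ≤ n}.Finite := by
    intro n
    induction n with
    | zero =>
      refine (Set.finite_singleton (1 : W)).subset ?_
      rintro x ⟨-, hx⟩
      exact cs.length_eq_zero_iff.1 (Nat.le_zero.1 hx)
    | succ n ih =>
      refine ((Set.finite_singleton (1 : W)).union (hfin.image2 (· * ·) ih)).subset ?_
      rintro x ⟨hx, hl⟩
      by_cases h1 : x = 1
      · exact Or.inl h1
      · obtain ⟨s, hs, x', hx', h, hl'⟩ := exists_left_factor cs hI hx h1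
        exact Or.inr ⟨s, hs, x', ⟨hx', by omega⟩, h.symm⟩
  refine (hball (cs.length m)).subset fun x hx => ⟨hx, ?_⟩
  have := length_mul_inv_add_of_descents cs hI hm hx
  omega

theorem isLongest_of_descents (hI : I ⊆ simpleSet cs) {m : W} (hmI : m ∈ par I)
    (hm : ∀ s ∈ I, cs.length (m * s) < cs.length m) : IsLongest cs I m := by
  refine ⟨hmI, fun x hx => ?_⟩
  have := length_mul_inv_add_of_descents cs hI hm hx
  omega

theorem exists_isLongest (hfin : (par I : Set W).Finite) : ∃ w, IsLongest cs I w := by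
  obtain ⟨w, hw, h⟩ := Set.exists_max_image _ cs.length hfin ⟨1, one_mem (par I)⟩
  exact ⟨w, hw, h⟩

theorem eq_of_par_eq {J : Set W} (hI : I ⊆ simpleSet cs) (hJ : J ⊆ simpleSet cs)
    (h : par I = par J) : I = J := by
  have key : ∀ {I J : Set W}, I ⊆ simpleSet cs → J ⊆ simpleSet cs → par I = par J → I ⊆ J := by
    intro I J hI hJ h s hs
    have h1 := length_of_mem_simpleSet cs (hI hs)
    refine mem_of_mem_par_of_length_le_one cs hJ (h ▸ Subgroup.subset_closure hs) ?_ h1.le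
    rintro rfl
    simp at h1
  exact (key hI hJ h).antisymm (key hJ hI h.symm)

theorem conj_image_par_eq_iff {J : Set W} {y : W} :
    (fun u => y * u * y⁻¹) '' (par J : Set W) = (par I : Set W) ↔
      ∀ t, t ∈ par I ↔ y⁻¹ * t * y ∈ par J := by
  rw [Set.ext_iff]
  refine forall_congr' fun t => ?_
  have : t ∈ (fun u => y * u * y⁻¹) '' (par J : Set W) ↔ y⁻¹ * t * y ∈ par J := by
    constructor
    · rintro ⟨u, hu, rfl⟩
      simpa [mul_assoc] using hu
    · intro h
      exact ⟨_, h, by group⟩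
  rw [this]
  exact Iff.comm

end Parabolic

/-- Let `u ∈ W_{Σ ∪ {s}}` be nontrivial, minimal in `W_Σ u`, with `u⁻¹ Σ u ⊆ Σ ∪ {s}`. Then
`W_{Σ ∪ {s}}` is finite with longest element `w₀^Σ u`. -/
theorem finite_par_and_isLongest_mul {Sg : Set W} {s w0 u : W} (hSg : Sg ⊆ simpleSet cs)
    (hfin : (par Sg : Set W).Finite) (hs : s ∈ simpleSet cs) (hsSg : s ∉ Sg)
    (hw0 : IsLongest cs Sg w0) (hu : u ∈ par (insert s Sg)) (hu1 : u ≠ 1)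
    (humin : u ∈ minLeft cs Sg) (hconj : ∀ a ∈ Sg, u⁻¹ * a * u ∈ insert s Sg) :
    (par (insert s Sg) : Set W).Finite ∧ IsLongest cs (insert s Sg) (w0 * u) := by
  have hI : insert s Sg ⊆ simpleSet cs := Set.insert_subset hs hSg
  have hSgfin : Sg.Finite := hfin.subset Subgroup.subset_closure
  have hIfin : (insert s Sg).Finite := hSgfin.insert s
  have hlw0 : cs.length (w0 * u) = cs.length w0 + cs.length u :=
    length_mul_of_mem_minLeft cs hSg hw0.1 humin
  set J : Set W := (fun a => u⁻¹ * a * u) '' Sg with hJ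
  have hJI : J ⊆ insert s Sg := by
    rintro _ ⟨a, ha, rfl⟩
    exact hconj a ha
  have hJcard : J.ncard = Sg.ncard := Set.ncard_image_of_injective _ fun a b h => by simpa using h
  have hdiff : (insert s Sg \ J).ncard = 1 := by
    rw [Set.ncard_sdiff hJI (hIfin.subset hJI), Set.ncard_insert_of_notMem hsSg hSgfin, hJcard]
    omega
  obtain ⟨r, hr⟩ := Set.ncard_eq_one.1 hdiff
  have hdescJ : ∀ j ∈ J, cs.length (w0 * u * j) < cs.length (w0 * u) ∧
      ¬ cs.length (u * j) < cs.length u := by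
    rintro _ ⟨a, ha, rfl⟩
    have haP : a ∈ par Sg := Subgroup.subset_closure ha
    have har := isReflection_of_mem_simpleSet cs (hSg ha)
    have e1 : w0 * u * (u⁻¹ * a * u) = w0 * a * u := by group
    have e2 : u * (u⁻¹ * a * u) = a * u := by group
    have l1 := length_mul_of_mem_minLeft cs hSg (mul_mem hw0.1 haP) humin
    have l2 := length_mul_of_mem_minLeft cs hSg haP humin
    have l3 := hw0.2 _ (mul_mem hw0.1 haP)
    have l4 := har.length_mul_left_ne w0
    simp only [e1, e2]
    omega
  obtain ⟨r', hr'I, u', -, huu', hlu⟩ := exists_right_factor cs hI hu hu1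
  have hr'r := isReflection_of_mem_simpleSet cs (hI hr'I)
  have hur' : u * r' = u' := by rw [huu', mul_assoc, hr'r.mul_self, mul_one]
  have hr'J : r' ∉ J := fun h => (hdescJ r' h).2 (by rw [hur']; omega)
  have hdesc : ∀ i ∈ insert s Sg, cs.length (w0 * u * i) < cs.length (w0 * u) := by
    intro i hi
    by_cases hiJ : i ∈ J
    · exact (hdescJ i hiJ).1
    · have h1 : i ∈ ({r} : Set W) := hr ▸ ⟨hi, hiJ⟩
      have h2 : r' ∈ ({r} : Set W) := hr ▸ ⟨hr'I, hr'J⟩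
      rw [Set.mem_singleton_iff] at h1 h2
      rw [h1, ← h2, mul_assoc, hur', hlw0]
      have := cs.length_mul_le w0 u'
      omega
  exact ⟨finite_par_of_descents cs hI hIfin hdesc, isLongest_of_descents cs hI
    (mul_mem (Subgroup.closure_mono (Set.subset_insert s Sg) hw0.1) hu) hdesc⟩

theorem eq_of_conj_image_par_eq {Sg Sg' : Set W} (hSg : GoodSubset cs Sg)
    (hSg' : Sg' ⊆ simpleSet cs) {y : W} (hy : y ∈ minRight cs Sg')
    (hconj : ∀ t, t ∈ par Sg ↔ y⁻¹ * t * y ∈ par Sg') : Sg' = Sg := by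
  obtain ⟨hS, hfin, hgood⟩ := hSg
  induction hn : cs.length y using Nat.strong_induction_on generalizing y with
  | _ n ih =>
  subst hn
  by_cases hy1 : y = 1
  · subst hy1
    refine eq_of_par_eq cs hSg' hS (Subgroup.ext fun t => ?_)
    simpa using (hconj t).symm
  have hyL : y ∈ minLeft cs Sg := mem_minLeft_of_conj cs hSg' hy fun t ht => (hconj t).1 ht
  obtain ⟨i, hi⟩ := cs.exists_leftDescent_of_ne_one hy1
  set s := cs.simple i with hs
  have hsS : s ∈ simpleSet cs := ⟨i, rfl⟩
  have hsinv : s ∈ invSet cs y := ⟨cs.isReflection_simple i, hi⟩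
  have hsSg : s ∉ Sg := fun h =>
    Set.eq_empty_iff_forall_notMem.1 hyL s ⟨hsinv, mem_parRefl_of_mem h⟩
  have hI : insert s Sg ⊆ simpleSet cs := Set.insert_subset hsS hS
  have hle : par Sg ≤ par (insert s Sg) := Subgroup.closure_mono (Set.subset_insert s Sg)
  obtain ⟨u, hu, v, hv, rfl⟩ := exists_mem_par_mul_minLeft cs (I := insert s Sg) y
  have hl := length_mul_of_mem_minLeft cs hI hu hv
  have hu1 : u ≠ 1 := by
    rintro rfl
    rw [one_mul] at hsinv
    exact Set.eq_empty_iff_forall_notMem.1 hv s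
      ⟨hsinv, mem_parRefl_of_mem (Set.mem_insert s Sg)⟩
  have hupos : 0 < cs.length u :=
    Nat.pos_of_ne_zero fun h => hu1 (cs.length_eq_zero_iff.1 h)
  have hyR := minRight_iff_inv_minLeft cs |>.1 hy
  have hua : ∀ a ∈ Sg, u⁻¹ * a * u ∈ insert s Sg := by
    intro a ha
    have haP : a ∈ par Sg := Subgroup.subset_closure ha
    have hb : (u * v)⁻¹ * a * (u * v) ∈ Sg' := by
      have := conj_mem_of_mem_minLeft cs hSg' hyR (hS ha) (by simpa using (hconj a).1 haP)
      simpa using this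
    have e : v * ((u * v)⁻¹ * a * (u * v)) * v⁻¹ = u⁻¹ * a * u := by group
    have := conj_mem_of_mem_minLeft cs hI hv (hSg' hb)
      (by rw [e]; exact mul_mem (mul_mem (inv_mem hu) (hle haP)) hu)
    rwa [e] at this
  obtain ⟨w0, hw0⟩ := exists_isLongest cs hfin
  obtain ⟨hIfin, hlong⟩ := finite_par_and_isLongest_mul cs hS hfin hsS hsSg hw0 hu hu1
    (mem_minLeft_of_length_mul cs hl hyL) hua
  have hnorm := (conj_image_par_eq_iff).1
    (hgood _ (Set.subset_insert s Sg) hI hIfin _ hlong)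
  refine ih (cs.length v) (by omega) (mem_minRight_of_length_mul cs hl hy) (fun t => ?_) rfl
  have h1 := hnorm (w0 * (u * t * u⁻¹) * w0⁻¹)
  rw [show (w0 * u)⁻¹ * (w0 * (u * t * u⁻¹) * w0⁻¹) * (w0 * u) = t by group,
    Subgroup.mul_mem_cancel_right _ (inv_mem hw0.1), Subgroup.mul_mem_cancel_left _ hw0.1,
    hconj] at h1
  rw [← h1, show (u * v)⁻¹ * (u * t * u⁻¹) * (u * v) = v⁻¹ * t * v by group]

/-- if `Σ' ⊊ S` with `W_{Σ'}` finite and `y' ∈ W^{Σ'}` satisfies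
`y' W_{Σ'} y'⁻¹ = W_Σ`, then `Σ' = Σ`; moreover `W̃` acts simply transitively on the
set of cosets `y W_Σ` with `y ∈ W^Σ` and `y W_Σ y⁻¹ = W_Σ`. -/
theorem fixed_chambers (Sg : Set W) (hSg : GoodSubset cs Sg) :
    (∀ Sg' : Set W, Sg' ⊂ simpleSet cs → ((par Sg' : Set W)).Finite →
      ∀ y' ∈ minRight cs Sg',
        (fun u => y' * u * y'⁻¹) '' (par Sg' : Set W) = (par Sg : Set W) → Sg' = Sg) ∧
    (∀ y : W, y ∈ minRight cs Sg →
      (fun u => y * u * y⁻¹) '' (par Sg : Set W) = (par Sg : Set W) →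
      ∃! w : W, w ∈ relW cs Sg ∧ w⁻¹ * y ∈ par Sg) := by
  refine ⟨fun Sg' hSg' _ y' hy' hconj => eq_of_conj_image_par_eq cs hSg hSg'.1 hy'
    (conj_image_par_eq_iff.1 hconj), fun y hy hconj => ?_⟩
  have hconj' := conj_image_par_eq_iff.1 hconj
  have hyL : y ∈ minLeft cs Sg := mem_minLeft_of_conj cs hSg.1 hy fun t ht => (hconj' t).1 ht
  refine ⟨y, ⟨⟨hconj, hyL⟩, by simp [one_mem]⟩, ?_⟩
  rintro w ⟨⟨hw, hwL⟩, hwy⟩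
  have hq : y * w⁻¹ ∈ par Sg := by
    rw [conj_image_par_eq_iff.1 hw]
    simpa [mul_assoc] using hwy
  have h1 := length_mul_of_mem_minLeft cs hSg.1 hq hwL
  have h2 := length_mul_of_mem_minLeft cs hSg.1 (inv_mem hq) hyL
  rw [inv_mul_cancel_right] at h1
  rw [cs.length_inv, show (y * w⁻¹)⁻¹ * y = w by group] at h2
  have h3 : y * w⁻¹ = 1 := cs.length_eq_zero_iff.1 (by omega)
  exact (mul_inv_eq_one.1 h3).symm

end RelativeCoxeter
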